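/- arXiv:1309.4505 — 2 statements merged into one kernel-verified Lean document; each statement's English description precedes it below -/
import Mathlib

section
/- Let n ≥ 1, 1 < q < ∞, and 1 ≤ k, m ≤ n. There exists a constant C = C(n, q) > 0 such that for every θ ∈ C_c^∞(ℝⁿ₊) (smooth, compactly supported in the open half-space), ‖ ∂_k ∂_m 𝒩(∂ₙθ) ‖_{L^q(ℝⁿ₊)} ≤ C ( ‖ θ ‖_{L^q(ℝⁿ₊)} + ‖ ∇²θ ‖_{L^q(ℝⁿ₊)} ), where ∇²θ denotes the collection of all second-order partial derivatives of θ. -/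
open MeasureTheory ENNReal

noncomputable section

/-- Points of `ℝⁿ` with `n = m + 1`, written as pairs `x = (x′, xₙ)`. -/
abbrev HalfSpacePt (m : ℕ) := (Fin m → ℝ) × ℝ

/-- The Gauss kernel `G_t(x) = (4πt)^{-n/2} exp(-|x|²/(4t))` in dimension `n = m + 1`. -/
def gauss (m : ℕ) (t : ℝ) (x : HalfSpacePt m) : ℝ :=
  (4 * Real.pi * t) ^ (-((m : ℝ) + 1) / 2) *
    Real.exp (-((∑ i, x.1 i ^ 2) + x.2 ^ 2) / (4 * t))

/-- The open upper half-space `ℝⁿ₊ = {x : xₙ > 0}`. -/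
def halfSpace (m : ℕ) : Set (HalfSpacePt m) := {x | 0 < x.2}

/-- The Dirichlet heat operator
`E(t)f(x) = ∫_{ℝⁿ₊} [G_t(x′−y′, xₙ−yₙ) − G_t(x′−y′, xₙ+yₙ)] f(y) dy`. -/
def Eheat (m : ℕ) (t : ℝ) (f : HalfSpacePt m → ℝ) (x : HalfSpacePt m) : ℝ :=
  ∫ y in halfSpace m,
    (gauss m t (x.1 - y.1, x.2 - y.2) - gauss m t (x.1 - y.1, x.2 + y.2)) * f y

/-- The Neumann heat operator
`F(t)f(x) = ∫_{ℝⁿ₊} [G_t(x′−y′, xₙ−yₙ) + G_t(x′−y′, xₙ+yₙ)] f(y) dy`. -/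
def Fheat (m : ℕ) (t : ℝ) (f : HalfSpacePt m → ℝ) (x : HalfSpacePt m) : ℝ :=
  ∫ y in halfSpace m,
    (gauss m t (x.1 - y.1, x.2 - y.2) + gauss m t (x.1 - y.1, x.2 + y.2)) * f y

/-- The Neumann potential operator `𝒩f(x) = ∫₀^∞ F(τ)f(x) dτ`. -/
def neumannPotential (m : ℕ) (f : HalfSpacePt m → ℝ) (x : HalfSpacePt m) : ℝ :=
  ∫ τ in Set.Ioi (0 : ℝ), Fheat m τ f x

/-- `∂_{xₙ} G_t`, the partial derivative of the Gauss kernel in the last coordinate. -/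
def gaussDn (m : ℕ) (t : ℝ) (z : HalfSpacePt m) : ℝ :=
  deriv (fun w => gauss m t (z.1, w)) z.2

/-- The `i`-th standard coordinate vector of `ℝⁿ`, `n = m + 1` (the case `i = n`
being the inward normal direction `eₙ`). -/
def coordVec (m : ℕ) (i : Fin (m + 1)) : HalfSpacePt m :=
  if h : (i : ℕ) < m then (Pi.single ⟨i, h⟩ 1, 0) else (0, 1)

/-- **Young's inequality** for the convolution of an integrable weight with an `L^q` function, in
terms of functions with values in `ℝ≥0∞`. -/
theorem eLpNorm_lintegral_mul_sub_le {E : Type*} [AddCommGroup E] [MeasurableSpace E]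
    [MeasurableAdd₂ E] [MeasurableNeg E] {μ : Measure E} [SFinite μ] [μ.IsAddRightInvariant]
    {q : ℝ≥0∞} (hq : 1 ≤ q) (hq' : q ≠ ⊤) {W g : E → ℝ≥0∞} (hW : Measurable W)
    (hWi : ∫⁻ y, W y ∂μ ≠ ⊤) (hg : Measurable g) :
    eLpNorm (fun x => ∫⁻ y, W y * g (x - y) ∂μ) q μ ≤ (∫⁻ y, W y ∂μ) * eLpNorm g q μ := by
  have hq0 : q ≠ 0 := (zero_lt_one.trans_le hq).ne'
  have hr : 1 ≤ q.toReal := by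
    simpa using (ENNReal.toReal_le_toReal one_ne_top hq').2 hq
  have hr0 : 0 < q.toReal := by linarith
  set r := q.toReal
  set A := ∫⁻ y, W y ∂μ
  have hA : (μ.withDensity W) Set.univ = A := by simp [A]
  have : IsFiniteMeasure (μ.withDensity W) := ⟨by rw [hA]; exact hWi.lt_top⟩
  have hg' : Measurable fun p : E × E => g (p.1 - p.2) := by fun_prop
  have key : ∀ x, (∫⁻ y, W y * g (x - y) ∂μ) ^ r ≤
      A ^ (r - 1) * ∫⁻ y, W y * g (x - y) ^ r ∂μ := by
    intro x
    have hgx : Measurable fun y => g (x - y) := hg.comp (measurable_const.sub measurable_id)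
    have h := eLpNorm_le_eLpNorm_mul_rpow_measure_univ (μ := μ.withDensity W) hq
      hgx.aestronglyMeasurable
    rw [hA, eLpNorm_one_eq_lintegral_enorm, eLpNorm_eq_lintegral_rpow_enorm_toReal hq0 hq'] at h
    simp only [enorm_eq_self] at h
    rw [lintegral_withDensity_eq_lintegral_mul _ hW hgx,
      lintegral_withDensity_eq_lintegral_mul _ hW (hgx.pow_const _)] at h
    have h2 := ENNReal.rpow_le_rpow h hr0.le
    rw [ENNReal.mul_rpow_of_nonneg _ _ hr0.le, ← ENNReal.rpow_mul, ← ENNReal.rpow_mul] at h2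
    have e1 : 1 / q.toReal * r = 1 := one_div_mul_cancel hr0.ne'
    have e2 : (1 / (1 : ℝ≥0∞).toReal - 1 / q.toReal) * r = r - 1 := by
      rw [ENNReal.toReal_one, sub_mul, one_div_mul_cancel hr0.ne']; simp
    rw [e1, e2, ENNReal.rpow_one, mul_comm (lintegral _ _)] at h2
    exact h2
  rw [eLpNorm_eq_lintegral_rpow_enorm_toReal hq0 hq',
    eLpNorm_eq_lintegral_rpow_enorm_toReal hq0 hq']
  simp only [enorm_eq_self]
  have e3 : A = (A ^ r) ^ (1 / r) := by
    rw [← ENNReal.rpow_mul, mul_one_div_cancel hr0.ne', ENNReal.rpow_one]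
  rw [e3, ← ENNReal.mul_rpow_of_nonneg _ _ (by positivity)]
  refine ENNReal.rpow_le_rpow ?_ (by positivity)
  calc ∫⁻ x, (∫⁻ y, W y * g (x - y) ∂μ) ^ r ∂μ
      ≤ ∫⁻ x, A ^ (r - 1) * ∫⁻ y, W y * g (x - y) ^ r ∂μ ∂μ := lintegral_mono key
    _ = A ^ (r - 1) * ∫⁻ x, ∫⁻ y, W y * g (x - y) ^ r ∂μ ∂μ := by
        rw [lintegral_const_mul]
        exact Measurable.lintegral_prod_right (by fun_prop)
    _ = A ^ (r - 1) * ∫⁻ y, ∫⁻ x, W y * g (x - y) ^ r ∂μ ∂μ := by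
        rw [lintegral_lintegral_swap]
        exact Measurable.aemeasurable (by fun_prop)
    _ = A ^ (r - 1) * ∫⁻ y, W y * ∫⁻ x, g x ^ r ∂μ ∂μ := by
        congr 2 with y
        rw [lintegral_const_mul _ (by fun_prop), lintegral_sub_right_eq_self (fun x => g x ^ r)]
    _ = A ^ r * ∫⁻ x, g x ^ r ∂μ := by
        rw [lintegral_mul_const _ hW, ← mul_assoc]
        congr 1
        rcases eq_or_ne A 0 with h0 | h0
        · simp [A] at h0
          simp [A, h0, hr0]
        · change A ^ (r - 1) * A = A ^ r
          nth_rewrite 2 [← ENNReal.rpow_one A]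
          rw [← ENNReal.rpow_add _ _ h0 hWi]; simp

/-- Integration by parts moves a derivative from one factor of a convolution to the other. -/
theorem integral_mul_fderiv_comp_sub {E : Type*} [NormedAddCommGroup E] [NormedSpace ℝ E]
    [FiniteDimensional ℝ E] [MeasurableSpace E] [BorelSpace E] {μ : Measure E}
    [μ.IsAddHaarMeasure] {p g : E → ℝ} (hp : ContDiff ℝ 1 p) (hg : ContDiff ℝ 1 g)
    (hgs : HasCompactSupport g) (x v : E) :
    ∫ y, p y * fderiv ℝ g (x - y) v ∂μ = ∫ y, fderiv ℝ p y v * g (x - y) ∂μ := by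
  have hd : ∀ y, fderiv ℝ (fun y => g (x - y)) y v = - fderiv ℝ g (x - y) v := by
    intro y
    have h := ((hg.differentiable one_ne_zero (x - y)).hasFDerivAt.comp y
      ((hasFDerivAt_id y).const_sub x)).fderiv
    simp only [Function.comp_def] at h
    rw [h]; simp
  have hs : HasCompactSupport fun y => g (x - y) :=
    hgs.comp_homeomorph (Homeomorph.subLeft x)
  have hs' : HasCompactSupport fun y => fderiv ℝ g (x - y) v :=
    (hgs.fderiv_apply ℝ v).comp_homeomorph (Homeomorph.subLeft x)
  have hc' : Continuous fun y => fderiv ℝ g y v :=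
    (hg.continuous_fderiv one_ne_zero).clm_apply continuous_const
  have hgc := hg.continuous
  have hpc := hp.continuous
  have hpc' : Continuous fun y => fderiv ℝ p y v :=
    (hp.continuous_fderiv one_ne_zero).clm_apply continuous_const
  have hgd : ContDiff ℝ 1 fun y => g (x - y) := hg.comp (contDiff_const.sub contDiff_id)
  have := integral_mul_fderiv_eq_neg_fderiv_mul_of_integrable (μ := μ) (f := p)
    (g := fun y => g (x - y)) (v := v)
    (Continuous.integrable_of_hasCompactSupport (by fun_prop) (hs.mul_left))
    (by
      simp only [hd, mul_neg]
      exact (Continuous.integrable_of_hasCompactSupport (by fun_prop) (hs'.mul_left)).neg)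
    (Continuous.integrable_of_hasCompactSupport (by fun_prop) (hs.mul_left))
    (fun y _ => hp.differentiable one_ne_zero y)
    (fun y _ => hgd.differentiable one_ne_zero y)
  simp only [hd, mul_neg, integral_neg, neg_inj] at this
  exact this

/-- The `i`-th coordinate functional on `ℝⁿ`, `n = m + 1`. -/
def coordCLM (m : ℕ) (i : Fin (m + 1)) : HalfSpacePt m →L[ℝ] ℝ :=
  if h : (i : ℕ) < m then
    (ContinuousLinearMap.proj (R := ℝ) (φ := fun _ : Fin m => ℝ) ⟨i, h⟩).comp
      (ContinuousLinearMap.fst ℝ (Fin m → ℝ) ℝ)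
  else ContinuousLinearMap.snd ℝ (Fin m → ℝ) ℝ

theorem coordCLM_last (m : ℕ) (z : HalfSpacePt m) : coordCLM m (Fin.last m) z = z.2 := by
  simp [coordCLM]

theorem coordCLM_castSucc (m : ℕ) (i : Fin m) (z : HalfSpacePt m) :
    coordCLM m i.castSucc z = z.1 i := by
  simp [coordCLM]

theorem coordVec_last (m : ℕ) : coordVec m (Fin.last m) = (0, 1) := by
  simp [coordVec]

theorem coordCLM_coordVec (m : ℕ) (i j : Fin (m + 1)) :
    coordCLM m i (coordVec m j) = if i = j then 1 else 0 := by
  induction i using Fin.lastCases with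
  | last =>
    rw [coordCLM_last]
    induction j using Fin.lastCases with
    | last => simp [coordVec]
    | cast j => simp [coordVec, (Fin.castSucc_lt_last j).ne']
  | cast i =>
    rw [coordCLM_castSucc]
    induction j using Fin.lastCases with
    | last => simp [coordVec, (Fin.castSucc_lt_last i).ne]
    | cast j => simp [coordVec, Pi.single_apply]

theorem norm_coordVec_le (m : ℕ) (i : Fin (m + 1)) : ‖coordVec m i‖ ≤ 1 := by
  unfold coordVec
  split_ifs with h
  · simp [Prod.norm_def, Pi.norm_single]
  · simp [Prod.norm_def]

/-- The squared Euclidean length of a point of `ℝⁿ`. -/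
def sqLen (m : ℕ) (z : HalfSpacePt m) : ℝ := ∑ i, coordCLM m i z ^ 2

theorem sqLen_eq (m : ℕ) (z : HalfSpacePt m) : sqLen m z = (∑ i, z.1 i ^ 2) + z.2 ^ 2 := by
  simp [sqLen, Fin.sum_univ_castSucc, coordCLM_last, coordCLM_castSucc]

theorem sqLen_nonneg (m : ℕ) (z : HalfSpacePt m) : 0 ≤ sqLen m z :=
  Finset.sum_nonneg fun _ _ => sq_nonneg _

theorem abs_coordCLM_le (m : ℕ) (i : Fin (m + 1)) (z : HalfSpacePt m) :
    |coordCLM m i z| ≤ √(sqLen m z) :=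
  Real.abs_le_sqrt (Finset.single_le_sum (f := fun i => coordCLM m i z ^ 2)
    (fun _ _ => sq_nonneg _) (Finset.mem_univ i))

theorem gauss_eq (m : ℕ) (t : ℝ) (z : HalfSpacePt m) : gauss m t z =
    (4 * Real.pi * t) ^ (-((m : ℝ) + 1) / 2) * Real.exp (-sqLen m z / (4 * t)) := by
  rw [gauss, sqLen_eq]

theorem gauss_nonneg (m : ℕ) {t : ℝ} (ht : 0 < t) (z : HalfSpacePt m) : 0 ≤ gauss m t z := by
  unfold gauss; positivity

theorem hasFDerivAt_sqLen (m : ℕ) (z : HalfSpacePt m) :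
    HasFDerivAt (sqLen m) (∑ i, (2 * coordCLM m i z) • coordCLM m i) z := by
  unfold sqLen
  refine HasFDerivAt.fun_sum fun i _ => ?_
  simpa using (coordCLM m i).hasFDerivAt.pow 2

theorem contDiff_gauss (m : ℕ) (t : ℝ) : ContDiff ℝ 1 (gauss m t) := by
  simp only [funext (gauss_eq m t), sqLen]
  fun_prop

theorem hasFDerivAt_gauss (m : ℕ) (t : ℝ) (z : HalfSpacePt m) :
    HasFDerivAt (gauss m t)
      ((-(gauss m t z) / (2 * t)) • ∑ i, coordCLM m i z • coordCLM m i) z := by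
  have h := (((hasFDerivAt_sqLen m z).neg.mul_const (4 * t)⁻¹).exp).const_mul
    ((4 * Real.pi * t) ^ (-((m : ℝ) + 1) / 2))
  rw [funext (gauss_eq m t)]
  simp only [div_eq_mul_inv] at *
  refine h.congr_fderiv ?_
  ext v
  all_goals simp [Finset.smul_sum]
  all_goals refine Finset.sum_congr rfl fun i _ => by ring

theorem fderiv_gauss_coordVec (m : ℕ) (t : ℝ) (z : HalfSpacePt m) (i : Fin (m + 1)) :
    fderiv ℝ (gauss m t) z (coordVec m i) = -(coordCLM m i z) / (2 * t) * gauss m t z := by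
  rw [(hasFDerivAt_gauss m t z).fderiv]
  simp [coordCLM_coordVec]
  ring

/-- The first partial derivative of the Gauss kernel in direction `a`. -/
def gaussD1 (m : ℕ) (a : Fin (m + 1)) (t : ℝ) (z : HalfSpacePt m) : ℝ :=
  -(coordCLM m a z) / (2 * t) * gauss m t z

/-- The second partial derivative of the Gauss kernel in directions `a, b`. -/
def gaussD2 (m : ℕ) (a b : Fin (m + 1)) (t : ℝ) (z : HalfSpacePt m) : ℝ :=
  (coordCLM m a z * coordCLM m b z / (4 * t ^ 2) - (if a = b then 1 else 0) / (2 * t)) *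
    gauss m t z

/-- The third partial derivative of the Gauss kernel in directions `a, b, c`. -/
def gaussD3 (m : ℕ) (a b c : Fin (m + 1)) (t : ℝ) (z : HalfSpacePt m) : ℝ :=
  (-(coordCLM m a z * coordCLM m b z * coordCLM m c z) / (8 * t ^ 3) +
    (coordCLM m a z * (if b = c then 1 else 0) + coordCLM m b z * (if a = c then 1 else 0) +
      coordCLM m c z * (if a = b then 1 else 0)) / (4 * t ^ 2)) * gauss m t z

theorem contDiff_gaussD1 (m : ℕ) (a : Fin (m + 1)) (t : ℝ) : ContDiff ℝ 1 (gaussD1 m a t) := by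
  have := contDiff_gauss m t
  unfold gaussD1
  simp only [div_eq_mul_inv]
  fun_prop

theorem contDiff_gaussD2 (m : ℕ) (a b : Fin (m + 1)) (t : ℝ) :
    ContDiff ℝ 1 (gaussD2 m a b t) := by
  have := contDiff_gauss m t
  unfold gaussD2
  simp only [div_eq_mul_inv]
  fun_prop

theorem fderiv_gaussD1 (m : ℕ) (a b : Fin (m + 1)) (t : ℝ) (z : HalfSpacePt m) :
    fderiv ℝ (gaussD1 m a t) z (coordVec m b) = gaussD2 m a b t z := by
  have h := (((coordCLM m a).hasFDerivAt (x := z)).neg.mul_const (2 * t)⁻¹).mul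
    ((contDiff_gauss m t).differentiable one_ne_zero z).hasFDerivAt
  have e : gaussD1 m a t = (fun z => (-⇑(coordCLM m a)) z * (2 * t)⁻¹) * gauss m t := by
    ext z; simp [gaussD1, div_eq_mul_inv]
  rw [e, h.fderiv]
  simp only [add_apply, smul_apply, fderiv_gauss_coordVec,
    coordCLM_coordVec, gaussD2, neg_apply, smul_eq_mul, Pi.neg_apply]
  ring

theorem fderiv_gaussD2 (m : ℕ) (a b c : Fin (m + 1)) (t : ℝ) (z : HalfSpacePt m) :
    fderiv ℝ (gaussD2 m a b t) z (coordVec m c) = gaussD3 m a b c t z := by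
  have h := (((((coordCLM m a).hasFDerivAt (x := z)).mul
    ((coordCLM m b).hasFDerivAt (x := z))).mul_const (4 * t ^ 2)⁻¹).sub_const
      ((if a = b then 1 else 0) / (2 * t))).mul
    ((contDiff_gauss m t).differentiable one_ne_zero z).hasFDerivAt
  have e : gaussD2 m a b t = (fun z => (⇑(coordCLM m a) * ⇑(coordCLM m b)) z * (4 * t ^ 2)⁻¹ -
      (if a = b then 1 else 0) / (2 * t)) * gauss m t := by
    ext z; simp [gaussD2, div_eq_mul_inv]
  rw [e, h.fderiv]
  simp only [add_apply, smul_apply, fderiv_gauss_coordVec,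
    coordCLM_coordVec, gaussD3, smul_eq_mul, Pi.mul_apply]
  ring

theorem gauss_eq_gauss_two_mul (m : ℕ) {t : ℝ} (ht : 0 < t) (z : HalfSpacePt m) :
    gauss m t z = (2 : ℝ) ^ (((m : ℝ) + 1) / 2) * Real.exp (-sqLen m z / (8 * t)) *
      gauss m (2 * t) z := by
  rw [gauss_eq, gauss_eq, show 4 * Real.pi * (2 * t) = 2 * (4 * Real.pi * t) by ring,
    Real.mul_rpow (x := 2) (y := 4 * Real.pi * t) (by norm_num) (by positivity), neg_div,
    Real.rpow_neg (x := 2) (by norm_num)]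
  have h2 : (0 : ℝ) < 2 ^ (((m : ℝ) + 1) / 2) := by positivity
  have he : Real.exp (-sqLen m z / (4 * t)) =
      Real.exp (-sqLen m z / (8 * t)) * Real.exp (-sqLen m z / (4 * (2 * t))) := by
    rw [← Real.exp_add]
    congr 1
    field_simp
    ring
  rw [he]
  field_simp

theorem gauss_le (m : ℕ) {t : ℝ} (ht : 1 ≤ t) (z : HalfSpacePt m) :
    gauss m t z ≤ t ^ (-(1 / 2) : ℝ) := by
  have ht0 : 0 < t := by linarith
  have hpi := Real.pi_gt_three
  have h1 : Real.exp (-sqLen m z / (4 * t)) ≤ 1 := by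
    rw [Real.exp_le_one_iff]
    exact div_nonpos_of_nonpos_of_nonneg (neg_nonpos.2 (sqLen_nonneg m z)) (by positivity)
  rw [gauss_eq]
  calc _ ≤ (4 * Real.pi * t) ^ (-((m : ℝ) + 1) / 2) * 1 := by gcongr
    _ ≤ (4 * Real.pi * t) ^ (-(1 / 2) : ℝ) := by
        rw [mul_one]
        refine Real.rpow_le_rpow_of_exponent_le (by nlinarith) ?_
        have : (0 : ℝ) ≤ m := Nat.cast_nonneg m
        linarith
    _ ≤ t ^ (-(1 / 2) : ℝ) :=
        Real.rpow_le_rpow_of_nonpos ht0 (by nlinarith) (by norm_num)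

theorem rpow_neg_half_eq {t : ℝ} (ht : 0 < t) : t ^ (-(1 / 2) : ℝ) = (√t)⁻¹ := by
  rw [Real.rpow_neg ht.le, Real.sqrt_eq_rpow]

theorem rpow_neg_three_halves_eq {t : ℝ} (ht : 0 < t) : t ^ (-(3 / 2) : ℝ) = (√t ^ 3)⁻¹ := by
  rw [Real.rpow_neg ht.le, Real.sqrt_eq_rpow, ← Real.rpow_natCast, ← Real.rpow_mul ht.le]
  norm_num

theorem abs_gaussD1_le_of_norm_le (m : ℕ) (a : Fin (m + 1)) {t R : ℝ} (ht : 1 ≤ t)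
    {z : HalfSpacePt m} (hz : |coordCLM m a z| ≤ R) :
    |gaussD1 m a t z| ≤ R * t ^ (-(3 / 2) : ℝ) := by
  have ht0 : 0 < t := by linarith
  have hs : √t * √t = t := Real.mul_self_sqrt ht0.le
  have hs0 : 0 < √t := Real.sqrt_pos.2 ht0
  have h := gauss_le m ht z
  rw [rpow_neg_half_eq ht0] at h
  rw [rpow_neg_three_halves_eq ht0, gaussD1, abs_mul, abs_div, abs_neg,
    abs_of_nonneg (gauss_nonneg m ht0 z), abs_of_pos (show 0 < 2 * t by positivity)]
  have hR : 0 ≤ R := (abs_nonneg _).trans hz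
  calc _ ≤ R / t * (√t)⁻¹ := by
        gcongr
        · exact gauss_nonneg m ht0 z
        · linarith
    _ = _ := by
      nth_rewrite 1 [← hs]
      field_simp

theorem abs_gaussD1_le (m : ℕ) (a : Fin (m + 1)) {t : ℝ} (ht : 0 < t) (z : HalfSpacePt m) :
    |gaussD1 m a t z| ≤
      (2 : ℝ) ^ (((m : ℝ) + 1) / 2) * t ^ (-(1 / 2) : ℝ) * gauss m (2 * t) z := by
  have hs : √t ^ 2 = t := Real.sq_sqrt ht.le
  have hs0 : 0 < √t := Real.sqrt_pos.2 ht
  set σ := √t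
  have hN : √(sqLen m z) ^ 2 = sqLen m z := Real.sq_sqrt (sqLen_nonneg m z)
  set r := √(sqLen m z)
  have hg := gauss_nonneg m (show 0 < 2 * t by positivity) z
  have ha := abs_coordCLM_le m a z
  have hE : Real.exp (-sqLen m z / (8 * t)) = (Real.exp ((r / σ) ^ 2 / 8))⁻¹ := by
    rw [← Real.exp_neg, ← hN, ← hs]
    congr 1
    field_simp
  rw [rpow_neg_half_eq ht, gaussD1, gauss_eq_gauss_two_mul m ht, hE, abs_mul, abs_div, abs_neg,
    abs_of_pos (show 0 < 2 * t by positivity), abs_mul _ (gauss m (2 * t) z), abs_of_nonneg hg,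
    abs_of_nonneg (show 0 ≤ (2 : ℝ) ^ (((m : ℝ) + 1) / 2) * (Real.exp ((r / σ) ^ 2 / 8))⁻¹ by
      positivity)]
  have hexp := Real.add_one_le_exp ((r / σ) ^ 2 / 8)
  have hle : r / σ / 2 * (Real.exp ((r / σ) ^ 2 / 8))⁻¹ ≤ 1 := by
    rw [mul_inv_le_iff₀ (Real.exp_pos _)]
    nlinarith [sq_nonneg (r / σ - 2)]
  calc _ ≤ r / (2 * t) * (2 ^ (((m : ℝ) + 1) / 2) * (Real.exp ((r / σ) ^ 2 / 8))⁻¹ *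
        gauss m (2 * t) z) := by gcongr
    _ = (2 ^ (((m : ℝ) + 1) / 2) * σ⁻¹ * gauss m (2 * t) z) *
        (r / σ / 2 * (Real.exp ((r / σ) ^ 2 / 8))⁻¹) := by
        rw [← hs]; field_simp
    _ ≤ _ := mul_le_of_le_one_right (by positivity) hle

theorem abs_gaussD3_le (m : ℕ) (a b c : Fin (m + 1)) {t : ℝ} (ht : 0 < t) (z : HalfSpacePt m) :
    |gaussD3 m a b c t z| ≤
      20 * (2 : ℝ) ^ (((m : ℝ) + 1) / 2) * t ^ (-(3 / 2) : ℝ) * gauss m (2 * t) z := by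
  have hs : √t ^ 2 = t := Real.sq_sqrt ht.le
  have hs0 : 0 < √t := Real.sqrt_pos.2 ht
  set σ := √t
  have hN : √(sqLen m z) ^ 2 = sqLen m z := Real.sq_sqrt (sqLen_nonneg m z)
  have hr0 : 0 ≤ √(sqLen m z) := Real.sqrt_nonneg _
  have ha := abs_coordCLM_le m a z
  have hb := abs_coordCLM_le m b z
  have hc := abs_coordCLM_le m c z
  set r := √(sqLen m z)
  have hg := gauss_nonneg m (show 0 < 2 * t by positivity) z
  have hE : Real.exp (-sqLen m z / (8 * t)) = (Real.exp ((r / σ) ^ 2 / 8))⁻¹ := by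
    rw [← Real.exp_neg, ← hN, ← hs]
    congr 1
    field_simp
  have hdelta : ∀ x y : Fin (m + 1), |(if x = y then 1 else 0 : ℝ)| ≤ 1 := by
    intro x y; split_ifs <;> simp
  have hcub : |coordCLM m a z * coordCLM m b z * coordCLM m c z| ≤ r ^ 3 := by
    rw [abs_mul, abs_mul, show r ^ 3 = r * r * r by ring]
    gcongr
  have hmul : ∀ (i x y : Fin (m + 1)), |coordCLM m i z| ≤ r →
      |coordCLM m i z * (if x = y then 1 else 0 : ℝ)| ≤ r := by
    intro i x y hi
    rw [abs_mul, ← mul_one r]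
    exact mul_le_mul hi (hdelta x y) (abs_nonneg _) hr0
  have hlin : |coordCLM m a z * (if b = c then 1 else 0) + coordCLM m b z *
      (if a = c then 1 else 0) + coordCLM m c z * (if a = b then 1 else 0)| ≤ 3 * r := by
    have h1 := hmul a b c ha
    have h2 := hmul b a c hb
    have h3 := hmul c a b hc
    refine (abs_add_le _ _).trans ?_
    have := abs_add_le (coordCLM m a z * (if b = c then 1 else 0 : ℝ)) (coordCLM m b z *
      (if a = c then 1 else 0))
    linarith
  have hpoly : |-(coordCLM m a z * coordCLM m b z * coordCLM m c z) / (8 * t ^ 3) +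
    (coordCLM m a z * (if b = c then 1 else 0) + coordCLM m b z * (if a = c then 1 else 0) +
      coordCLM m c z * (if a = b then 1 else 0)) / (4 * t ^ 2)| ≤
      r ^ 3 / (8 * t ^ 3) + 3 * r / (4 * t ^ 2) := by
    refine (abs_add_le _ _).trans ?_
    rw [abs_div, abs_div, abs_neg, abs_of_pos (show 0 < 8 * t ^ 3 by positivity),
      abs_of_pos (show 0 < 4 * t ^ 2 by positivity)]
    gcongr
  have hle : ((r / σ) ^ 3 / 8 + 3 * (r / σ) / 4) * (Real.exp ((r / σ) ^ 2 / 8))⁻¹ ≤ 20 := by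
    rw [mul_inv_le_iff₀ (Real.exp_pos _)]
    have hx : 0 ≤ r / σ := by positivity
    have hexp := Real.quadratic_le_exp_of_nonneg (show 0 ≤ (r / σ) ^ 2 / 8 by positivity)
    set x := r / σ
    nlinarith [sq_nonneg (x ^ 2 - 4 * x), sq_nonneg (x - 2), sq_nonneg (x ^ 2)]
  rw [rpow_neg_three_halves_eq ht, gaussD3, gauss_eq_gauss_two_mul m ht, hE, abs_mul,
    abs_mul _ (gauss m (2 * t) z), abs_of_nonneg hg, abs_of_nonneg
      (show 0 ≤ (2 : ℝ) ^ (((m : ℝ) + 1) / 2) * (Real.exp ((r / σ) ^ 2 / 8))⁻¹ by positivity)]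
  calc _ ≤ (r ^ 3 / (8 * t ^ 3) + 3 * r / (4 * t ^ 2)) *
        (2 ^ (((m : ℝ) + 1) / 2) * (Real.exp ((r / σ) ^ 2 / 8))⁻¹ *
        gauss m (2 * t) z) := by gcongr
    _ = (2 ^ (((m : ℝ) + 1) / 2) * (σ ^ 3)⁻¹ * gauss m (2 * t) z) *
        (((r / σ) ^ 3 / 8 + 3 * (r / σ) / 4) * (Real.exp ((r / σ) ^ 2 / 8))⁻¹) := by
        rw [← hs]; field_simp
    _ ≤ (2 ^ (((m : ℝ) + 1) / 2) * (σ ^ 3)⁻¹ * gauss m (2 * t) z) * 20 := by gcongr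
    _ = _ := by ring

theorem lintegral_gauss (m : ℕ) {t : ℝ} (ht : 0 < t) :
    ∫⁻ z, ENNReal.ofReal (gauss m t z) = 1 := by
  have hb : 0 < (4 * t)⁻¹ := by positivity
  have hG := integrable_exp_neg_mul_sq hb
  have hGp := Integrable.fintype_prod (ι := Fin m)
    (f := fun _ s => Real.exp (-(4 * t)⁻¹ * s ^ 2)) (μ := fun _ => volume) fun _ => hG
  have e : gauss m t = fun z => (4 * Real.pi * t) ^ (-((m : ℝ) + 1) / 2) *
      ((∏ i, Real.exp (-(4 * t)⁻¹ * z.1 i ^ 2)) * Real.exp (-(4 * t)⁻¹ * z.2 ^ 2)) := by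
    ext z
    rw [gauss, ← Real.exp_sum, ← Real.exp_add, ← Finset.mul_sum]
    congr 2
    field_simp
    ring
  have hGi : Integrable (gauss m t) := by
    rw [e]
    exact (hGp.mul_prod hG).const_mul _
  rw [← ofReal_integral_eq_lintegral_ofReal hGi (.of_forall fun z => gauss_nonneg m ht z), e,
    integral_const_mul, Measure.volume_eq_prod, integral_prod_mul
      (fun x : Fin m → ℝ => ∏ i, Real.exp (-(4 * t)⁻¹ * x i ^ 2))
      (fun s => Real.exp (-(4 * t)⁻¹ * s ^ 2)),
    integral_fintype_prod_volume_eq_pow (fun s => Real.exp (-(4 * t)⁻¹ * s ^ 2)),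
    integral_gaussian, Fintype.card_fin, ← pow_succ, div_inv_eq_mul,
    show Real.pi * (4 * t) = 4 * Real.pi * t by ring, Real.sqrt_eq_rpow,
    ← Real.rpow_natCast, ← Real.rpow_mul (by positivity), ← Real.rpow_add (by positivity)]
  push_cast
  rw [show -((m : ℝ) + 1) / 2 + 1 / 2 * (m + 1) = 0 by ring]
  simp

/-- `L^q` bound for the superposition over `τ ∈ T` of convolutions with the kernels `K τ`. -/
theorem exists_lintegral_bound_convolution_superposition {E : Type*} [AddCommGroup E]
    [MeasurableSpace E] [MeasurableAdd₂ E] [MeasurableNeg E] {μ : Measure E} [SFinite μ]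
    [μ.IsAddRightInvariant] {q : ℝ≥0∞} (hq : 1 ≤ q) (hq' : q ≠ ⊤) {K : ℝ → E → ℝ}
    (hK : Measurable fun p : ℝ × E => K p.1 p.2) {T : Set ℝ}
    (hKi : ∫⁻ τ in T, ∫⁻ y, ‖K τ y‖ₑ ∂μ ≠ ⊤) {g : E → ℝ} (hg : Measurable g) :
    ∃ h : E → ℝ≥0∞, Measurable h ∧
      (∀ x, ‖∫ τ in T, ∫ y, K τ y * g (x - y) ∂μ‖ₑ ≤ h x) ∧
      eLpNorm h q μ ≤ (∫⁻ τ in T, ∫⁻ y, ‖K τ y‖ₑ ∂μ) * eLpNorm g q μ := by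
  have hK' : Measurable fun p : E × ℝ => ‖K p.2 p.1‖ₑ := (hK.comp measurable_swap).enorm
  have hW : Measurable fun y => ∫⁻ τ in T, ‖K τ y‖ₑ := hK'.lintegral_prod_right'
  have hswap : ∫⁻ τ in T, ∫⁻ y, ‖K τ y‖ₑ ∂μ = ∫⁻ y, (∫⁻ τ in T, ‖K τ y‖ₑ) ∂μ :=
    lintegral_lintegral_swap hK.enorm.aemeasurable
  refine ⟨fun x => ∫⁻ y, (∫⁻ τ in T, ‖K τ y‖ₑ) * ‖g (x - y)‖ₑ ∂μ, ?_, fun x => ?_, ?_⟩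
  · have : Measurable fun p : E × E => ‖g (p.1 - p.2)‖ₑ :=
      (hg.comp (measurable_fst.sub measurable_snd)).enorm
    exact Measurable.lintegral_prod_right' (f := fun p : E × E =>
      (∫⁻ τ in T, ‖K τ p.2‖ₑ) * ‖g (p.1 - p.2)‖ₑ) ((hW.comp measurable_snd).mul this)
  · have hgx : Measurable fun y => ‖g (x - y)‖ₑ :=
      (hg.comp (measurable_const.sub measurable_id)).enorm
    calc ‖∫ τ in T, ∫ y, K τ y * g (x - y) ∂μ‖ₑ
        ≤ ∫⁻ τ in T, ∫⁻ y, ‖K τ y‖ₑ * ‖g (x - y)‖ₑ ∂μ := by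
          refine (enorm_integral_le_lintegral_enorm _).trans (lintegral_mono fun τ => ?_)
          refine (enorm_integral_le_lintegral_enorm _).trans (lintegral_mono fun y => ?_)
          rw [enorm_mul]
      _ = ∫⁻ y, (∫⁻ τ in T, ‖K τ y‖ₑ * ‖g (x - y)‖ₑ) ∂μ :=
          lintegral_lintegral_swap (hK.enorm.mul (hgx.comp measurable_snd)).aemeasurable
      _ = _ := by
          congr 1 with y
          rw [lintegral_mul_const]
          exact hK'.comp measurable_prodMk_left
  · rw [hswap] at hKi ⊢
    refine (eLpNorm_lintegral_mul_sub_le hq hq' hW hKi hg.enorm).trans_eq ?_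
    rw [eLpNorm_enorm]

theorem measurable_gauss (m : ℕ) :
    Measurable fun p : ℝ × HalfSpacePt m => gauss m p.1 p.2 := by
  unfold gauss
  fun_prop

theorem measurable_gaussD1 (m : ℕ) (a : Fin (m + 1)) :
    Measurable fun p : ℝ × HalfSpacePt m => gaussD1 m a p.1 p.2 := by
  have := measurable_gauss m
  unfold gaussD1
  fun_prop

theorem measurable_gaussD3 (m : ℕ) (a b c : Fin (m + 1)) :
    Measurable fun p : ℝ × HalfSpacePt m => gaussD3 m a b c p.1 p.2 := by
  have := measurable_gauss m
  unfold gaussD3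
  fun_prop

theorem lintegral_enorm_le_of_abs_le_gauss (m : ℕ) {t c : ℝ} (ht : 0 < t) (hc : 0 ≤ c)
    {f : HalfSpacePt m → ℝ} (hf : ∀ z, |f z| ≤ c * gauss m (2 * t) z) :
    ∫⁻ z, ‖f z‖ₑ ≤ ENNReal.ofReal c := by
  calc ∫⁻ z, ‖f z‖ₑ ≤ ∫⁻ z, ENNReal.ofReal c * ENNReal.ofReal (gauss m (2 * t) z) := by
        refine lintegral_mono fun z => ?_
        rw [← ENNReal.ofReal_mul hc, ← ofReal_norm]
        exact ENNReal.ofReal_le_ofReal (hf z)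
    _ = ENNReal.ofReal c := by
        rw [lintegral_const_mul' _ _ ENNReal.ofReal_ne_top, lintegral_gauss m (by positivity),
          mul_one]

theorem lintegral_gaussD1_ne_top (m : ℕ) (a : Fin (m + 1)) :
    ∫⁻ τ in Set.Ioc (0 : ℝ) 1, ∫⁻ z, ‖gaussD1 m a τ z‖ₑ ≠ ⊤ := by
  have hi : IntegrableOn
      (fun τ : ℝ => (2 : ℝ) ^ (((m : ℝ) + 1) / 2) * τ ^ (-(1 / 2) : ℝ)) (Set.Ioc 0 1) :=
    ((intervalIntegral.intervalIntegrable_rpow' (a := 0) (b := 1)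
      (by norm_num : (-1 : ℝ) < -(1 / 2))).1).const_mul _
  refine ((setLIntegral_mono' measurableSet_Ioc fun τ hτ => ?_).trans_lt hi.2).ne
  have hτ0 := hτ.1
  rw [Real.enorm_of_nonneg (by positivity)]
  exact lintegral_enorm_le_of_abs_le_gauss m hτ0 (by positivity) fun z => abs_gaussD1_le m a hτ0 z

theorem lintegral_gaussD3_ne_top (m : ℕ) (a b c : Fin (m + 1)) :
    ∫⁻ τ in Set.Ioi (1 : ℝ), ∫⁻ z, ‖gaussD3 m a b c τ z‖ₑ ≠ ⊤ := by
  have hi : IntegrableOn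
      (fun τ : ℝ => 20 * (2 : ℝ) ^ (((m : ℝ) + 1) / 2) * τ ^ (-(3 / 2) : ℝ)) (Set.Ioi 1) :=
    (integrableOn_Ioi_rpow_of_lt (by norm_num) one_pos).const_mul _
  refine ((setLIntegral_mono' measurableSet_Ioi fun τ hτ => ?_).trans_lt hi.2).ne
  have hτ0 : 0 < τ := one_pos.trans hτ
  rw [Real.enorm_of_nonneg (by positivity)]
  exact lintegral_enorm_le_of_abs_le_gauss m hτ0 (by positivity)
    fun z => abs_gaussD3_le m a b c hτ0 z

theorem lintegral_gaussD1_Ioi_one_ne_top (m : ℕ) (a : Fin (m + 1)) {K : Set (HalfSpacePt m)}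
    (hK : IsCompact K) :
    ∫⁻ τ in Set.Ioi (1 : ℝ), ∫⁻ z in K, ‖gaussD1 m a τ z‖ₑ ≠ ⊤ := by
  obtain ⟨R, hR⟩ := hK.exists_bound_of_continuousOn (coordCLM m a).continuous.continuousOn
  have hi : IntegrableOn (fun τ : ℝ => R * τ ^ (-(3 / 2) : ℝ)) (Set.Ioi 1) :=
    (integrableOn_Ioi_rpow_of_lt (by norm_num) one_pos).const_mul _
  have hfin : ∫⁻ τ in Set.Ioi (1 : ℝ), ‖R * τ ^ (-(3 / 2) : ℝ)‖ₑ * volume K ≠ ⊤ := by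
    rw [lintegral_mul_const' _ _ hK.measure_lt_top.ne]
    exact (ENNReal.mul_lt_top hi.2 hK.measure_lt_top).ne
  refine ((setLIntegral_mono' measurableSet_Ioi fun τ hτ => ?_).trans_lt hfin.lt_top).ne
  rw [← setLIntegral_const]
  refine setLIntegral_mono' hK.measurableSet fun z hz => ?_
  exact enorm_le_iff_norm_le.2 ((abs_gaussD1_le_of_norm_le m a (le_of_lt hτ) (hR z hz)).trans
    (le_abs_self _))

theorem integrable_gaussD1_prod (m : ℕ) (a : Fin (m + 1)) {K : Set (HalfSpacePt m)}
    (hK : IsCompact K) :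
    Integrable (fun p : ℝ × HalfSpacePt m => gaussD1 m a p.1 p.2)
      ((volume.restrict (Set.Ioi 0)).prod (volume.restrict K)) := by
  have hm := measurable_gaussD1 m a
  refine ⟨hm.aestronglyMeasurable, ?_⟩
  rw [HasFiniteIntegral, lintegral_prod _ hm.enorm.aemeasurable,
    ← Set.Ioc_union_Ioi_eq_Ioi zero_le_one,
    lintegral_union measurableSet_Ioi (Set.Ioc_disjoint_Ioi le_rfl)]
  refine ENNReal.add_lt_top.2 ⟨?_, (lintegral_gaussD1_Ioi_one_ne_top m a hK).lt_top⟩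
  exact (lintegral_mono fun τ => setLIntegral_le_lintegral _ _).trans_lt
    (lintegral_gaussD1_ne_top m a).lt_top

/-- The derivative in direction `a` of the kernel `∫₀^∞ G_τ dτ` of the Newtonian potential. -/
def newtonD1 (m : ℕ) (a : Fin (m + 1)) (z : HalfSpacePt m) : ℝ :=
  ∫ τ in Set.Ioi (0 : ℝ), gaussD1 m a τ z

theorem locallyIntegrable_newtonD1 (m : ℕ) (a : Fin (m + 1)) :
    LocallyIntegrable (newtonD1 m a) volume :=
  locallyIntegrable_iff.2 fun _ hK => (integrable_gaussD1_prod m a hK).integral_prod_right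

theorem integrable_gaussD1_mul (m : ℕ) (a : Fin (m + 1)) {g : HalfSpacePt m → ℝ}
    (hg : Continuous g) (hgs : HasCompactSupport g) (x : HalfSpacePt m) :
    Integrable (fun p : ℝ × HalfSpacePt m => gaussD1 m a p.1 p.2 * g (x - p.2))
      ((volume.restrict (Set.Ioi 0)).prod volume) := by
  have hs : HasCompactSupport fun y => g (x - y) :=
    hgs.comp_homeomorph (Homeomorph.subLeft x)
  obtain ⟨B, hB⟩ := hgs.exists_bound_of_continuous hg
  have h := (integrable_gaussD1_prod m a hs).mul_bdd (c := B)
    (g := fun p : ℝ × HalfSpacePt m => g (x - p.2))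
    (by fun_prop) (.of_forall fun p => hB _)
  rw [← Measure.restrict_univ (μ := (volume.restrict (Set.Ioi (0 : ℝ)))),
    Measure.prod_restrict] at h
  refine (integrableOn_iff_integrable_of_support_subset fun p hp => ?_).1 h
  exact ⟨trivial, subset_tsupport _ (right_ne_zero_of_mul hp)⟩

theorem newtonD1_convolution (m : ℕ) (a : Fin (m + 1)) {g : HalfSpacePt m → ℝ}
    (hg : Continuous g) (hgs : HasCompactSupport g) (x : HalfSpacePt m) :
    ∫ y, newtonD1 m a y * g (x - y) =
      ∫ τ in Set.Ioi (0 : ℝ), ∫ y, gaussD1 m a τ y * g (x - y) := by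
  rw [integral_integral_swap (integrable_gaussD1_mul m a hg hgs x)]
  simp only [newtonD1, integral_mul_const]

open scoped Convolution in
theorem fderiv_fderiv_integral_mul_comp_sub {E : Type*} [NormedAddCommGroup E] [NormedSpace ℝ E]
    [FiniteDimensional ℝ E] [MeasurableSpace E] [BorelSpace E] {μ : Measure E}
    [μ.IsAddHaarMeasure] {N Θ : E → ℝ} (hN : LocallyIntegrable N μ) (hΘ : ContDiff ℝ 2 Θ)
    (hs : HasCompactSupport Θ) (x v w : E) :
    fderiv ℝ (fderiv ℝ fun x => ∫ y, N y * Θ (x - y) ∂μ) x v w =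
      ∫ y, N y * fderiv ℝ (fderiv ℝ Θ) (x - y) v w ∂μ := by
  let L := ContinuousLinearMap.mul ℝ ℝ
  have hΘ' : ContDiff ℝ 1 (fderiv ℝ Θ) := hΘ.fderiv_right (by norm_num)
  have h1 : fderiv ℝ (fun x => ∫ y, N y * Θ (x - y) ∂μ) =
      (N ⋆[L.precompR E, μ] fderiv ℝ Θ) := by
    ext1 x
    exact (hs.hasFDerivAt_convolution_right L hN (hΘ.of_le (by norm_num)) x).fderiv
  have hc := hΘ'.continuous_fderiv one_ne_zero
  have hcs := (hs.fderiv ℝ).fderiv ℝ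
  have hcv : HasCompactSupport fun y => fderiv ℝ (fderiv ℝ Θ) y v :=
    hcs.comp_left (g := fun A : E →L[ℝ] E →L[ℝ] ℝ => A v) rfl
  rw [h1, ((hs.fderiv ℝ).hasFDerivAt_convolution_right _ hN hΘ' x).fderiv,
    convolution_precompR_apply _ hN hcs hc,
    convolution_precompR_apply _ hN hcv (hc.clm_apply continuous_const)]
  rfl

theorem integral_gaussD1_mul_fderiv_fderiv (m : ℕ) (a k j : Fin (m + 1)) (t : ℝ)
    {Θ : HalfSpacePt m → ℝ} (hΘ : ContDiff ℝ 2 Θ) (hs : HasCompactSupport Θ)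
    (x : HalfSpacePt m) :
    ∫ y, gaussD1 m a t y * fderiv ℝ (fderiv ℝ Θ) (x - y) (coordVec m k) (coordVec m j) =
      ∫ y, gaussD3 m a k j t y * Θ (x - y) := by
  have hH : (volume : Measure (HalfSpacePt m)).IsAddHaarMeasure :=
    Measure.prod.instIsAddHaarMeasure _ _
  have hΘ' : ContDiff ℝ 1 (fderiv ℝ Θ) := hΘ.fderiv_right (by norm_num)
  have hj : ContDiff ℝ 1 fun y => fderiv ℝ Θ y (coordVec m j) := hΘ'.clm_apply contDiff_const
  have h1 := integral_mul_fderiv_comp_sub (μ := volume) (contDiff_gaussD1 m a t) hj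
    (hs.fderiv_apply ℝ _) x (coordVec m k)
  have h2 := integral_mul_fderiv_comp_sub (μ := volume) (contDiff_gaussD2 m a k t)
    (hΘ.of_le (by norm_num)) hs x (coordVec m j)
  simp only [fderiv_gaussD1] at h1
  simp only [fderiv_gaussD2] at h2
  rw [← h2, ← h1]
  congr 1 with y
  rw [fderiv_clm_apply (hΘ'.differentiable one_ne_zero _) (differentiableAt_const _)]
  simp

theorem exists_eLpNorm_fderiv_fderiv_newtonD1_le (m : ℕ) {q : ℝ≥0∞} (hq : 1 ≤ q) (hq' : q ≠ ⊤)
    (a k j : Fin (m + 1)) :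
    ∃ C : ℝ≥0∞, C ≠ ⊤ ∧ ∀ Θ : HalfSpacePt m → ℝ, ContDiff ℝ 2 Θ → HasCompactSupport Θ →
      eLpNorm (fun x => fderiv ℝ (fderiv ℝ fun x => ∫ y, newtonD1 m a y * Θ (x - y)) x
        (coordVec m k) (coordVec m j)) q volume ≤
      C * (eLpNorm Θ q volume + eLpNorm (fun x => fderiv ℝ (fderiv ℝ Θ) x
        (coordVec m k) (coordVec m j)) q volume) := by
  have hH : (volume : Measure (HalfSpacePt m)).IsAddHaarMeasure :=
    Measure.prod.instIsAddHaarMeasure _ _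
  have hA := lintegral_gaussD1_ne_top m a
  have hB := lintegral_gaussD3_ne_top m a k j
  refine ⟨_, ENNReal.add_ne_top.2 ⟨hA, hB⟩, fun Θ hΘ hs => ?_⟩
  set A := ∫⁻ τ in Set.Ioc (0 : ℝ) 1, ∫⁻ z, ‖gaussD1 m a τ z‖ₑ
  set B := ∫⁻ τ in Set.Ioi (1 : ℝ), ∫⁻ z, ‖gaussD3 m a k j τ z‖ₑ
  set D := fun x => fderiv ℝ (fderiv ℝ Θ) x (coordVec m k) (coordVec m j) with hD
  have hΘ' : ContDiff ℝ 1 (fderiv ℝ Θ) := hΘ.fderiv_right (by norm_num)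
  have hDc : Continuous D := ((hΘ'.continuous_fderiv one_ne_zero).clm_apply
    continuous_const).clm_apply continuous_const
  have hDs : HasCompactSupport D := ((hs.fderiv ℝ).fderiv ℝ).comp_left
    (g := fun A : HalfSpacePt m →L[ℝ] HalfSpacePt m →L[ℝ] ℝ => A (coordVec m k) (coordVec m j)) rfl
  obtain ⟨h₁, hm₁, hb₁, hn₁⟩ := exists_lintegral_bound_convolution_superposition hq hq'
    (measurable_gaussD1 m a) hA hDc.measurable
  obtain ⟨h₂, hm₂, hb₂, hn₂⟩ := exists_lintegral_bound_convolution_superposition hq hq'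
    (measurable_gaussD3 m a k j) hB hΘ.continuous.measurable
  have hpt : ∀ x, ‖fderiv ℝ (fderiv ℝ fun x => ∫ y, newtonD1 m a y * Θ (x - y)) x
      (coordVec m k) (coordVec m j)‖ₑ ≤ ‖(h₁ + h₂) x‖ₑ := by
    intro x
    have hi := (integrable_gaussD1_mul m a hDc hDs x).integral_prod_left
    rw [fderiv_fderiv_integral_mul_comp_sub (locallyIntegrable_newtonD1 m a) hΘ hs,
      newtonD1_convolution m a hDc hDs, ← Set.Ioc_union_Ioi_eq_Ioi zero_le_one,
      setIntegral_union (Set.Ioc_disjoint_Ioi le_rfl) measurableSet_Ioi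
        (hi.mono_measure (Measure.restrict_mono Set.Ioc_subset_Ioi_self le_rfl))
        (hi.mono_measure (Measure.restrict_mono (Set.Ioi_subset_Ioi zero_le_one) le_rfl))]
    refine (enorm_add_le _ _).trans (add_le_add (hb₁ x) ?_)
    simp only [hD, integral_gaussD1_mul_fderiv_fderiv m a k j _ hΘ hs x]
    exact hb₂ x
  calc _ ≤ eLpNorm (h₁ + h₂) q volume := eLpNorm_mono_enorm hpt
    _ ≤ eLpNorm h₁ q volume + eLpNorm h₂ q volume :=
        eLpNorm_add_le hm₁.aestronglyMeasurable hm₂.aestronglyMeasurable hq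
    _ ≤ A * eLpNorm D q volume + B * eLpNorm Θ q volume := add_le_add hn₁ hn₂
    _ ≤ (A + B) * eLpNorm D q volume + (A + B) * eLpNorm Θ q volume := by
        gcongr
        · exact le_self_add
        · exact le_add_self
    _ = _ := by rw [← mul_add, add_comm (eLpNorm D q volume)]

/-- The reflection `(x′, xₙ) ↦ (x′, -xₙ)`. -/
def reflLast (m : ℕ) : HalfSpacePt m ≃ₗᵢ[ℝ] HalfSpacePt m where
  toLinearEquiv := (LinearEquiv.refl ℝ (Fin m → ℝ)).prodCongr (LinearEquiv.neg ℝ)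
  norm_map' x := by simp [Prod.norm_def]

theorem reflLast_apply (m : ℕ) (x : HalfSpacePt m) : reflLast m x = (x.1, -x.2) := rfl

theorem measurePreserving_reflLast (m : ℕ) :
    MeasurePreserving (reflLast m) volume volume :=
  (MeasurePreserving.id volume).prod (Measure.measurePreserving_neg volume)

theorem Fheat_fderiv_eq (m : ℕ) (t : ℝ) {θ : HalfSpacePt m → ℝ} (hθ : ContDiff ℝ 1 θ)
    (hs : HasCompactSupport θ) (hsupp : tsupport θ ⊆ halfSpace m) (x : HalfSpacePt m) :
    Fheat m t (fun y => fderiv ℝ θ y (0, 1)) x =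
      ∫ y, gaussD1 m (Fin.last m) t y * (θ - θ ∘ reflLast m) (x - y) := by
  have hH : (volume : Measure (HalfSpacePt m)).IsAddHaarMeasure :=
    Measure.prod.instIsAddHaarMeasure _ _
  set f : HalfSpacePt m → ℝ := fun y => fderiv ℝ θ y (0, 1) with hf
  have hfc : Continuous f := (hθ.continuous_fderiv one_ne_zero).clm_apply continuous_const
  have hfs : HasCompactSupport f := hs.fderiv_apply ℝ _
  have hfsR : HasCompactSupport (f ∘ reflLast m) := hfs.comp_homeomorph (reflLast m).toHomeomorph
  have hG := (contDiff_gauss m t).continuous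
  have hfz : ∀ y ∉ halfSpace m, f y = 0 := fun y hy => by
    rw [hf]
    simp only
    rw [fderiv_of_notMem_tsupport ℝ (fun h => hy (hsupp h))]
    rfl
  have hR : ∀ y, reflLast m (reflLast m y) = y := fun y => by simp [reflLast_apply]
  have hfR : ∫ y, gauss m t (x - reflLast m y) * f y =
      ∫ y, gauss m t (x - y) * f (reflLast m y) := by
    rw [← (measurePreserving_reflLast m).integral_comp
      (reflLast m).toHomeomorph.measurableEmbedding]
    simp only [hR]
  have hΘs : HasCompactSupport (θ - θ ∘ reflLast m) :=
    hs.sub (hs.comp_homeomorph (reflLast m).toHomeomorph)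
  have hθR : ContDiff ℝ 1 (θ ∘ reflLast m) := hθ.comp (reflLast m).contDiff
  have hd : ∀ y, fderiv ℝ (θ - θ ∘ reflLast m) y (0, 1) = f y + f (reflLast m y) := by
    intro y
    have h2 := ((hθ.differentiable one_ne_zero (reflLast m y)).hasFDerivAt.comp y
      (reflLast m).toContinuousLinearEquiv.hasFDerivAt)
    rw [((hθ.differentiable one_ne_zero y).hasFDerivAt.sub h2).fderiv]
    have : reflLast m ((0 : Fin m → ℝ), (1 : ℝ)) = -(0, 1) := by simp [reflLast_apply]
    change f y - fderiv ℝ θ (reflLast m y) (reflLast m (0, 1)) = _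
    rw [this, map_neg, sub_neg_eq_add]
  have hIBP := integral_mul_fderiv_comp_sub (μ := volume) (g := θ - θ ∘ reflLast m)
    (contDiff_gauss m t) (hθ.sub hθR) hΘs x
    (coordVec m (Fin.last m))
  simp only [fderiv_gauss_coordVec] at hIBP
  simp only [gaussD1]
  rw [← hIBP, coordVec_last, Fheat, setIntegral_eq_integral_of_forall_compl_eq_zero
    (fun y hy => by rw [hfz y hy, mul_zero])]
  have hmul : ∀ {u v : HalfSpacePt m → ℝ}, Continuous u → Continuous v → HasCompactSupport v →
      Integrable fun y => u y * v y := fun hu hv hvs =>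
    (hu.mul hv).integrable_of_hasCompactSupport hvs.mul_left
  have hG₁ : Continuous fun y => gauss m t (x - y) := by fun_prop
  have hG₂ : Continuous fun y => gauss m t (x - reflLast m y) :=
    hG.comp (continuous_const.sub (reflLast m).continuous)
  calc _ = ∫ y, (gauss m t (x - y) * f y + gauss m t (x - reflLast m y) * f y) := by
        congr 1 with y
        rw [add_mul]
        congr 3
        ext <;> simp [reflLast_apply]
    _ = (∫ y, gauss m t (x - y) * f y) + ∫ y, gauss m t (x - reflLast m y) * f y :=
        integral_add (hmul hG₁ hfc hfs) (hmul hG₂ hfc hfs)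
    _ = ∫ y, (gauss m t (x - y) * f y + gauss m t (x - y) * f (reflLast m y)) := by
        rw [hfR]
        exact (integral_add (hmul hG₁ hfc hfs)
          (hmul hG₁ (hfc.comp (reflLast m).continuous) hfsR)).symm
    _ = ∫ y, gauss m t (x - y) * fderiv ℝ (θ - θ ∘ reflLast m) y (0, 1) := by
        simp only [hd, mul_add]
    _ = _ := by
        rw [← integral_sub_left_eq_self _ _ x]
        simp only [_root_.sub_sub_cancel]

theorem neumannPotential_fderiv_eq (m : ℕ) {θ : HalfSpacePt m → ℝ} (hθ : ContDiff ℝ 1 θ)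
    (hs : HasCompactSupport θ) (hsupp : tsupport θ ⊆ halfSpace m) :
    neumannPotential m (fun y => fderiv ℝ θ y (0, 1)) =
      fun x => ∫ y, newtonD1 m (Fin.last m) y * (θ - θ ∘ reflLast m) (x - y) := by
  have hΘs : HasCompactSupport (θ - θ ∘ reflLast m) :=
    hs.sub (hs.comp_homeomorph (reflLast m).toHomeomorph)
  have hΘ : ContDiff ℝ 1 (θ - θ ∘ reflLast m) := hθ.sub (hθ.comp (reflLast m).contDiff)
  ext x
  rw [newtonD1_convolution m _ hΘ.continuous hΘs, neumannPotential]
  simp only [Fheat_fderiv_eq m _ hθ hs hsupp]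

theorem eLpNorm_add_comp_reflLast_le (m : ℕ) {q : ℝ≥0∞} (hq : 1 ≤ q) {f : HalfSpacePt m → ℝ}
    (hf : Continuous f) (hsupp : Function.support f ⊆ halfSpace m) :
    eLpNorm (fun x => ‖f x‖ + ‖f (reflLast m x)‖) q volume ≤
      2 * eLpNorm f q (volume.restrict (halfSpace m)) := by
  have hfR : Continuous (f ∘ reflLast m) := hf.comp (reflLast m).continuous
  rw [eLpNorm_restrict_eq_of_support_subset hsupp, two_mul]
  refine (eLpNorm_add_le hf.norm.aestronglyMeasurable hfR.norm.aestronglyMeasurable hq).trans_eq ?_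
  have h2 : eLpNorm (fun x => ‖(f ∘ reflLast m) x‖) q volume = eLpNorm f q volume := by
    rw [eLpNorm_norm, eLpNorm_comp_measurePreserving hf.aestronglyMeasurable
      (measurePreserving_reflLast m)]
  exact congrArg₂ _ (eLpNorm_norm f) h2

/-- for `1 < q < ∞`, `1 ≤ k, m ≤ n` there is `C = C(n,q) > 0` with
`‖∂_k ∂_m 𝒩(∂ₙθ)‖_{L^q(ℝⁿ₊)} ≤ C (‖θ‖_{L^q(ℝⁿ₊)} + ‖∇²θ‖_{L^q(ℝⁿ₊)})`
for every `θ ∈ C_c^∞(ℝⁿ₊)` (`n = m' + 1`, indices `k j`). -/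
theorem neumannPotential_secondDeriv_Lq_bound (m : ℕ) (q : ℝ≥0∞) (hq1 : 1 < q)
    (hq2 : q ≠ ⊤) (k j : Fin (m + 1)) :
    ∃ C : ℝ, 0 < C ∧ ∀ θ : HalfSpacePt m → ℝ,
      ContDiff ℝ (⊤ : ℕ∞) θ → HasCompactSupport θ → tsupport θ ⊆ halfSpace m →
      eLpNorm
          (fun x : HalfSpacePt m =>
            fderiv ℝ (fderiv ℝ (neumannPotential m fun y => fderiv ℝ θ y (0, 1))) x
              (coordVec m k) (coordVec m j))
          q (volume.restrict (halfSpace m)) ≤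
        ENNReal.ofReal C *
          (eLpNorm θ q (volume.restrict (halfSpace m)) +
            eLpNorm (fun x : HalfSpacePt m => ‖iteratedFDeriv ℝ 2 θ x‖) q
              (volume.restrict (halfSpace m))) := by
  obtain ⟨C, hC, h⟩ := exists_eLpNorm_fderiv_fderiv_newtonD1_le m hq1.le hq2 (Fin.last m) k j
  have hC2 : 2 * C ≠ ⊤ := ENNReal.mul_ne_top (by simp) hC
  refine ⟨(2 * C).toReal + 1, by positivity, fun θ hθ hs hsupp => ?_⟩
  have hθ2 : ContDiff ℝ 2 θ := hθ.of_le (WithTop.coe_le_coe.2 (le_top : (2 : ℕ∞) ≤ ⊤))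
  have hθR : ContDiff ℝ 2 (θ ∘ reflLast m) := hθ2.comp (reflLast m).contDiff
  have hΘs : HasCompactSupport (θ - θ ∘ reflLast m) :=
    hs.sub (hs.comp_homeomorph (reflLast m).toHomeomorph)
  rw [neumannPotential_fderiv_eq m (hθ2.of_le (by norm_num)) hs hsupp]
  have h0 : eLpNorm (θ - θ ∘ reflLast m) q volume ≤
      2 * eLpNorm θ q (volume.restrict (halfSpace m)) :=
    (eLpNorm_mono_real fun x => norm_sub_le _ _).trans
      (eLpNorm_add_comp_reflLast_le m hq1.le hθ2.continuous ((subset_tsupport θ).trans hsupp))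
  have h2 : eLpNorm (fun x => fderiv ℝ (fderiv ℝ (θ - θ ∘ reflLast m)) x
        (coordVec m k) (coordVec m j)) q volume ≤
      2 * eLpNorm (fun x => ‖iteratedFDeriv ℝ 2 θ x‖) q (volume.restrict (halfSpace m)) := by
    refine (eLpNorm_mono_real fun x => ?_).trans
      (eLpNorm_add_comp_reflLast_le m hq1.le (hθ2.continuous_iteratedFDeriv le_rfl).norm ?_)
    · simp only [norm_norm]
      rw [← (reflLast m).norm_iteratedFDeriv_comp_right]
      refine le_trans ?_ (norm_sub_le _ _)
      rw [← iteratedFDeriv_sub_apply hθ2.contDiffAt hθR.contDiffAt]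
      have e := iteratedFDeriv_two_apply (𝕜 := ℝ) (θ - θ ∘ reflLast m) x
        ![coordVec m k, coordVec m j]
      simp only [Matrix.cons_val_zero, Matrix.cons_val_one] at e
      rw [← e]
      refine (ContinuousMultilinearMap.le_opNorm _ _).trans ?_
      refine mul_le_of_le_one_right (norm_nonneg _) ?_
      rw [Fin.prod_univ_two]
      exact mul_le_one₀ (norm_coordVec_le m k) (norm_nonneg _) (norm_coordVec_le m j)
    · refine fun x hx => hsupp (support_iteratedFDeriv_subset (𝕜 := ℝ) 2 fun h => hx ?_)
      simp [h]
  calc _ ≤ _ := eLpNorm_restrict_le _ _ _ _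
    _ ≤ C * (2 * eLpNorm θ q (volume.restrict (halfSpace m)) +
          2 * eLpNorm (fun x => ‖iteratedFDeriv ℝ 2 θ x‖) q (volume.restrict (halfSpace m))) :=
        (h (θ - θ ∘ reflLast m) (hθ2.sub hθR) hΘs).trans (by gcongr)
    _ = 2 * C * (eLpNorm θ q (volume.restrict (halfSpace m)) +
          eLpNorm (fun x => ‖iteratedFDeriv ℝ 2 θ x‖) q (volume.restrict (halfSpace m))) := by
        ring
    _ ≤ _ := by
        gcongr
        rw [← ENNReal.ofReal_toReal hC2]
        exact ENNReal.ofReal_le_ofReal (by rw [ENNReal.ofReal_toReal hC2]; linarith)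

end
end

section
/- Let n ≥ 1 and t > 0. Let f : ℝⁿ → ℝ be smooth with compact support contained in the closed half-space {xₙ ≥ 0}, and suppose f(x′, 0) = 0 for all x′ ∈ ℝ^{n−1}. Then for every x ∈ ℝⁿ₊, ∂ₙ(E(t)f)(x) = F(t)(∂ₙf)(x). -/
open MeasureTheory ENNReal

noncomputable section

/-- The reflection `(y′, yₙ) ↦ (y′, -yₙ)` across the boundary hyperplane. -/
def boundaryReflection (m : ℕ) : HalfSpacePt m ≃L[ℝ] HalfSpacePt m :=
  (ContinuousLinearEquiv.refl ℝ (Fin m → ℝ)).prodCongr (ContinuousLinearEquiv.neg ℝ)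

@[simp]
lemma boundaryReflection_apply (m : ℕ) (y : HalfSpacePt m) :
    boundaryReflection m y = (y.1, -y.2) := rfl

lemma measurePreserving_boundaryReflection (m : ℕ) :
    MeasurePreserving (boundaryReflection m) volume volume :=
  (MeasurePreserving.id (volume : Measure (Fin m → ℝ))).prod
    (Measure.measurePreserving_neg (volume : Measure ℝ))

lemma integral_comp_boundaryReflection (m : ℕ) (g : HalfSpacePt m → ℝ) :
    ∫ y, g (boundaryReflection m y) = ∫ y, g y :=
  (measurePreserving_boundaryReflection m).integral_comp
    (boundaryReflection m).toHomeomorph.measurableEmbedding g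

instance isAddHaarMeasure_volume_halfSpacePt (m : ℕ) :
    (volume : Measure (HalfSpacePt m)).IsAddHaarMeasure :=
  Measure.prod.instIsAddHaarMeasure (volume : Measure (Fin m → ℝ)) (volume : Measure ℝ)

lemma continuous_gauss (m : ℕ) (t : ℝ) : Continuous (gauss m t) := by
  unfold gauss
  fun_prop

/-- A continuous function vanishing on the open lower half-space vanishes on its closure. -/
lemma eq_zero_of_snd_nonpos {m : ℕ} {h : HalfSpacePt m → ℝ} (hc : Continuous h)
    (h0 : ∀ y : HalfSpacePt m, y.2 < 0 → h y = 0) {y : HalfSpacePt m} (hy : y.2 ≤ 0) :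
    h y = 0 := by
  have hcl : IsClosed {u : ℝ | h (y.1, u) = 0} :=
    isClosed_eq (by fun_prop) continuous_const
  have hsub : closure (Set.Iio (0 : ℝ)) ⊆ {u : ℝ | h (y.1, u) = 0} :=
    hcl.closure_subset_iff.2 fun u hu => h0 (y.1, u) hu
  rw [closure_Iio] at hsub
  exact hsub hy

/-- A half-space integral against the Gauss kernel plus `s` times its reflection is a convolution
over the whole space with the corresponding extension by reflection. -/
lemma integral_halfSpace_gauss_eq_convolution {m : ℕ} (t s : ℝ) {h : HalfSpacePt m → ℝ}
    (hc : Continuous h) (hcs : HasCompactSupport h)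
    (h0 : ∀ y : HalfSpacePt m, y.2 < 0 → h y = 0) (x : HalfSpacePt m) :
    ∫ y in halfSpace m,
        (gauss m t (x.1 - y.1, x.2 - y.2) + s * gauss m t (x.1 - y.1, x.2 + y.2)) * h y =
      convolution (gauss m t) (fun y => h y + s * h (boundaryReflection m y))
        (ContinuousLinearMap.mul ℝ ℝ) volume x := by
  have hG := continuous_gauss m t
  have hcr : HasCompactSupport fun y => h (boundaryReflection m y) :=
    hcs.comp_homeomorph (boundaryReflection m).toHomeomorph
  have hi₁ : Integrable fun y : HalfSpacePt m => gauss m t (x - y) * h y :=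
    Continuous.integrable_of_hasCompactSupport (by fun_prop) hcs.mul_left
  have hi₂ : Integrable fun y : HalfSpacePt m =>
      s * (gauss m t (x - boundaryReflection m y) * h y) :=
    Continuous.integrable_of_hasCompactSupport (by fun_prop) hcs.mul_left.mul_left
  have hi₃ : Integrable fun y : HalfSpacePt m =>
      s * (gauss m t (x - y) * h (boundaryReflection m y)) :=
    Continuous.integrable_of_hasCompactSupport (by fun_prop) hcr.mul_left.mul_left
  have hrefl : ∫ y : HalfSpacePt m, gauss m t (x - boundaryReflection m y) * h y =
      ∫ y, gauss m t (x - y) * h (boundaryReflection m y) := by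
    rw [← integral_comp_boundaryReflection]
    simp
  rw [setIntegral_eq_integral_of_forall_compl_eq_zero fun y hy => by
    rw [eq_zero_of_snd_nonpos hc h0 (not_lt.1 hy), mul_zero], convolution_eq_swap]
  calc
    _ = ∫ y : HalfSpacePt m, (gauss m t (x - y) * h y +
          s * (gauss m t (x - boundaryReflection m y) * h y)) := by
      refine integral_congr_ae (.of_forall fun y => ?_)
      have e₁ : x - y = (x.1 - y.1, x.2 - y.2) := rfl
      have e₂ : x - boundaryReflection m y = (x.1 - y.1, x.2 + y.2) := by
        ext <;> simp
      simp only [e₁, e₂]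
      ring
    _ = ∫ y : HalfSpacePt m, (gauss m t (x - y) * h y +
          s * (gauss m t (x - y) * h (boundaryReflection m y))) := by
      rw [integral_add hi₁ hi₂, integral_add hi₁ hi₃, integral_const_mul, integral_const_mul,
        hrefl]
    _ = _ := by
      refine integral_congr_ae (.of_forall fun y => ?_)
      simp only [ContinuousLinearMap.mul_apply']
      ring

/-- for `t > 0` and `f` smooth with compact support contained in the
closed half-space `{xₙ ≥ 0}` and vanishing on the boundary, for every `x ∈ ℝⁿ₊`,
`∂ₙ(E(t)f)(x) = F(t)(∂ₙf)(x)` (`n = m + 1`). -/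
theorem normalDeriv_Eheat_eq_Fheat (m : ℕ) (t : ℝ) (ht : 0 < t)
    (f : HalfSpacePt m → ℝ) (hf : ContDiff ℝ (⊤ : ℕ∞) f) (hfc : HasCompactSupport f)
    (hfs : tsupport f ⊆ {x : HalfSpacePt m | 0 ≤ x.2})
    (hf0 : ∀ x' : Fin m → ℝ, f (x', 0) = 0)
    (x : HalfSpacePt m) (hx : x ∈ halfSpace m) :
    HasDerivAt (fun z : ℝ => Eheat m t f (x.1, z))
      (Fheat m t (fun y => fderiv ℝ f y (0, 1)) x) x.2 := by
  have hfd : Differentiable ℝ f := hf.differentiable (by simp)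
  have hf' : Continuous (fderiv ℝ f) := hf.continuous_fderiv (by simp)
  have hneg : ∀ y : HalfSpacePt m, y.2 < 0 → y ∉ tsupport f :=
    fun y hy hy' => (hfs hy').not_gt hy
  have hz : ∀ y : HalfSpacePt m, y.2 < 0 → f y = 0 :=
    fun y hy => image_eq_zero_of_notMem_tsupport (hneg y hy)
  have hz' : ∀ y : HalfSpacePt m, y.2 < 0 → fderiv ℝ f y (0, 1) = 0 := fun y hy => by
    rw [fderiv_of_notMem_tsupport (𝕜 := ℝ) (hneg y hy)]
    rfl
  set g : HalfSpacePt m → ℝ := fun y => f y + (-1) * f (boundaryReflection m y) with hg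
  have hgs : ContDiff ℝ 1 g := by
    have : ContDiff ℝ 1 f := hf.of_le (by exact_mod_cast le_top)
    exact this.add (contDiff_const.mul (this.comp (boundaryReflection m).contDiff))
  have hgc : HasCompactSupport g :=
    hfc.add (hfc.comp_homeomorph (boundaryReflection m).toHomeomorph).mul_left
  have hg' : ∀ y, fderiv ℝ g y (0, 1) = fderiv ℝ f y (0, 1) +
      1 * fderiv ℝ f (boundaryReflection m y) (0, 1) := fun y => by
    have h₁ := (hfd y).hasFDerivAt.add
      (((hfd (boundaryReflection m y)).hasFDerivAt.comp y
        (boundaryReflection m).hasFDerivAt).const_mul (-1))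
    have h₂ : boundaryReflection m (0, 1) = -(0, 1) := by simp
    have h₃ : fderiv ℝ g y = _ := h₁.fderiv
    rw [h₃]
    change fderiv ℝ f y (0, 1) + (-1 : ℝ) *
      fderiv ℝ f (boundaryReflection m y) (boundaryReflection m (0, 1)) = _
    rw [h₂, map_neg]
    ring
  have hE : ∀ z : HalfSpacePt m, Eheat m t f z =
      convolution (gauss m t) g (ContinuousLinearMap.mul ℝ ℝ) volume z := fun z => by
    rw [hg, ← integral_halfSpace_gauss_eq_convolution t (-1) hf.continuous hfc hz z]
    simp only [Eheat, neg_one_mul, sub_eq_add_neg]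
  have hF : Fheat m t (fun y => fderiv ℝ f y (0, 1)) x =
      convolution (gauss m t) (fun y => fderiv ℝ g y (0, 1))
        (ContinuousLinearMap.mul ℝ ℝ) volume x := by
    simp only [hg']
    rw [← integral_halfSpace_gauss_eq_convolution t 1
      (h := fun y => fderiv ℝ f y (0, 1)) (by fun_prop) (hfc.fderiv_apply ℝ _) hz' x]
    simp only [Fheat, one_mul]
  have hG := (continuous_gauss m t).locallyIntegrable (μ := volume)
  have hD := hgc.hasFDerivAt_convolution_right (ContinuousLinearMap.mul ℝ ℝ) hG hgs x
  have hline : HasDerivAt (fun z : ℝ => (x.1, z)) ((0, 1) : HalfSpacePt m) x.2 :=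
    (hasDerivAt_const x.2 x.1).prodMk (hasDerivAt_id x.2)
  have := hD.comp_hasDerivAt x.2 hline
  rw [convolution_precompR_apply (ContinuousLinearMap.mul ℝ ℝ) hG (hgc.fderiv ℝ)
    (hgs.continuous_fderiv one_ne_zero), ← hF] at this
  simpa only [hE, Function.comp_def] using this

end
end
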